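/- Let m₂ < m₁ be nonnegative integers with m₁ + m₂ even and let p = (m₁+m₂+1)/2. Then for all 0 < a < b, M_{p,m₁,m₂}(a,b) = √(ab), where M_{p,m₁,m₂}(a,b) is the unique solution x ∈ (a,b) of (x-a)^{m₁-m₂} f[x, a^{m₁+1}, b^{m₂+1}] = (b-x)^{m₁-m₂} f[x, a^{m₂+1}, b^{m₁+1}] with f(x) = x^p. -/

import Mathlib

/-- `IsDD f x y z r s D` says that `D` is the value of the confluent divided difference
`f[x, y^r, z^s]` (node `y` repeated `r` times, node `z` repeated `s` times), characterized as
the leading coefficient of the Hermite interpolant of degree at most `r + s` matching `f` at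
`x` and matching `f` and its derivatives up to order `r - 1` at `y` and `s - 1` at `z`. -/
def IsDD (f : ℝ → ℝ) (x y z : ℝ) (r s : ℕ) (D : ℝ) : Prop :=
  ∃ H : Polynomial ℝ, H.natDegree ≤ r + s ∧ H.coeff (r + s) = D ∧
    H.eval x = f x ∧
    (∀ j < r, iteratedDeriv j (fun t => H.eval t) y = iteratedDeriv j f y) ∧
    (∀ j < s, iteratedDeriv j (fun t => H.eval t) z = iteratedDeriv j f z)

open Polynomial Set Filter Topology

theorem exists_finset_zeros_deriv {h h' : ℝ → ℝ} {a b : ℝ}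
    (hd : ∀ t ∈ Icc a b, HasDerivAt h (h' t) t) (S : Finset ℝ) (hS : ∀ t ∈ S, t ∈ Icc a b)
    (hz : ∀ t ∈ S, h t = 0) :
    ∃ T : Finset ℝ, (∀ t ∈ T, t ∈ Ioo a b ∧ h' t = 0) ∧ S.card ≤ T.card + 1 := by
  classical
  have key : ∀ q : ℝ × ℝ, ∃ z, q.1 ∈ S → q.2 ∈ S → q.1 < q.2 →
      z ∈ Ioo q.1 q.2 ∧ h' z = 0 := by
    rintro ⟨x, y⟩
    by_cases hq : x ∈ S ∧ y ∈ S ∧ x < y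
    · obtain ⟨hx, hy, hxy⟩ := hq
      have hsub : ∀ t ∈ Icc x y, t ∈ Icc a b := fun t ht =>
        ⟨(hS x hx).1.trans ht.1, ht.2.trans (hS y hy).2⟩
      obtain ⟨c, hc, hc'⟩ := exists_hasDerivAt_eq_zero hxy
        (fun t ht => (hd t (hsub t ht)).continuousAt.continuousWithinAt)
        ((hz x hx).trans (hz y hy).symm)
        (fun t ht => hd t (hsub t (Ioo_subset_Icc_self ht)))
      exact ⟨c, fun _ _ _ => ⟨hc, hc'⟩⟩
    · exact ⟨0, fun h1 h2 h3 => absurd ⟨h1, h2, h3⟩ hq⟩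
  choose c hc using key
  refine ⟨((S ×ˢ S).filter fun q => q.1 < q.2).image c, ?_, ?_⟩
  · intro t ht
    simp only [Finset.mem_image, Finset.mem_filter, Finset.mem_product] at ht
    obtain ⟨q, ⟨⟨h1, h2⟩, h3⟩, rfl⟩ := ht
    obtain ⟨h4, h5⟩ := hc q h1 h2 h3
    exact ⟨⟨(hS _ h1).1.trans_lt h4.1, h4.2.trans_le (hS _ h2).2⟩, h5⟩
  · refine Finset.card_le_of_interleaved fun x hx y hy hxy _ => ⟨c (x, y), ?_, ?_⟩
    · exact Finset.mem_image_of_mem _ (by simp [hx, hy, hxy])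
    · exact (hc (x, y) hx hy hxy).1

/-- Rolle's theorem with multiplicities: simple zeros on a finite set `S` inside `(a, b)` and
zeros of order `r` and `s` at the endpoints. -/
theorem exists_finset_zeros_iteratedDeriv {h : ℝ → ℝ} {a b : ℝ} (hab : a < b)
    (hh : ∀ t ∈ Icc a b, AnalyticAt ℝ h t) (S : Finset ℝ)
    (hS : ∀ t ∈ S, t ∈ Ioo a b ∧ h t = 0) {r s : ℕ}
    (hr : ∀ j < r, iteratedDeriv j h a = 0) (hs : ∀ j < s, iteratedDeriv j h b = 0) (j : ℕ) :
    ∃ T : Finset ℝ, (∀ t ∈ T, t ∈ Ioo a b ∧ iteratedDeriv j h t = 0) ∧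
      S.card + min j r + min j s ≤ T.card + j := by
  classical
  induction j with
  | zero => exact ⟨S, by simpa using hS, by simp⟩
  | succ j ih =>
    obtain ⟨T, hT, hcard⟩ := ih
    have haT : a ∉ T := fun h => lt_irrefl _ (hT a h).1.1
    have hbT : b ∉ T := fun h => lt_irrefl _ (hT b h).1.2
    have hd : ∀ t ∈ Icc a b,
        HasDerivAt (iteratedDeriv j h) (iteratedDeriv (j + 1) h t) t := by
      intro t ht
      rw [iteratedDeriv_succ, hasDerivAt_deriv_iff, iteratedDeriv_eq_iterate]
      exact ((hh t ht).iterated_deriv j).differentiableAt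
    let A : Finset ℝ := if j < r then {a} else ∅
    let B : Finset ℝ := if j < s then {b} else ∅
    have hA : ∀ t ∈ A, t = a ∧ j < r := by
      intro t ht; by_cases hj : j < r <;> simp_all [A]
    have hB : ∀ t ∈ B, t = b ∧ j < s := by
      intro t ht; by_cases hj : j < s <;> simp_all [B]
    have hcA : A.card + min j r = min (j + 1) r := by
      by_cases hj : j < r <;> simp [A, hj] <;> omega
    have hcB : B.card + min j s = min (j + 1) s := by
      by_cases hj : j < s <;> simp [B, hj] <;> omega
    have hdis : Disjoint A B := Finset.disjoint_left.2 fun t h1 h2 =>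
      hab.ne ((hA t h1).1.symm.trans (hB t h2).1)
    have hdis' : Disjoint T (A ∪ B) := by
      refine Finset.disjoint_left.2 fun t h1 h2 => ?_
      rcases Finset.mem_union.1 h2 with h2 | h2
      · exact haT ((hA t h2).1 ▸ h1)
      · exact hbT ((hB t h2).1 ▸ h1)
    have hmem : ∀ t ∈ T ∪ (A ∪ B), t ∈ Icc a b ∧ iteratedDeriv j h t = 0 := by
      intro t ht
      rcases Finset.mem_union.1 ht with h2 | h2
      · exact ⟨Ioo_subset_Icc_self (hT t h2).1, (hT t h2).2⟩
      rcases Finset.mem_union.1 h2 with h2 | h2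
      · obtain ⟨rfl, hj⟩ := hA t h2
        exact ⟨left_mem_Icc.2 hab.le, hr j hj⟩
      · obtain ⟨rfl, hj⟩ := hB t h2
        exact ⟨right_mem_Icc.2 hab.le, hs j hj⟩
    obtain ⟨T', hT', hc'⟩ := exists_finset_zeros_deriv hd (T ∪ (A ∪ B))
      (fun t ht => (hmem t ht).1) (fun t ht => (hmem t ht).2)
    refine ⟨T', hT', ?_⟩
    rw [Finset.card_union_of_disjoint hdis', Finset.card_union_of_disjoint hdis] at hc'
    omega

theorem analyticAt_eval (H : ℝ[X]) (c : ℝ) : AnalyticAt ℝ (fun t => H.eval t) c := by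
  simpa using (analyticAt_id (𝕜 := ℝ) (z := c)).aeval_polynomial H

theorem iteratedDeriv_eval (H : ℝ[X]) (j : ℕ) :
    iteratedDeriv j (fun t => H.eval t) = fun t => (derivative^[j] H).eval t := by
  induction j with
  | zero => simp
  | succ j ih =>
    rw [iteratedDeriv_succ, ih, Function.iterate_succ_apply']
    ext t
    exact Polynomial.deriv _

theorem natCast_le_analyticOrderAt_eval_iff (D : ℝ[X]) (c : ℝ) (r : ℕ) :
    (r : ℕ∞) ≤ analyticOrderAt (fun t => D.eval t) c ↔ (X - C c) ^ r ∣ D := by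
  rw [natCast_le_analyticOrderAt_iff_iteratedDeriv_eq_zero (analyticAt_eval D c)]
  simp only [iteratedDeriv_eval]
  by_cases hD : D = 0
  · simp [hD]
  rw [← le_rootMultiplicity_iff hD]
  cases r with
  | zero => simp
  | succ r =>
    rw [Nat.succ_le_iff, lt_rootMultiplicity_iff_isRoot_iterate_derivative hD]
    simp [IsRoot]

theorem natCast_le_analyticOrderAt_sub_eval {f : ℝ → ℝ} {H : ℝ[X]} {c : ℝ} {r : ℕ}
    (hf : AnalyticAt ℝ f c)
    (h : ∀ j < r, iteratedDeriv j (fun t => H.eval t) c = iteratedDeriv j f c) :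
    (r : ℕ∞) ≤ analyticOrderAt (fun t => f t - H.eval t) c := by
  rw [natCast_le_analyticOrderAt_iff_iteratedDeriv_eq_zero (hf.fun_sub (analyticAt_eval H c))]
  intro j hj
  rw [iteratedDeriv_fun_sub hf.contDiffAt (analyticAt_eval H c).contDiffAt, h j hj, sub_self]

theorem le_analyticOrderAt_sub_eval_add {f : ℝ → ℝ} {H D : ℝ[X]} {c : ℝ} {r : ℕ}
    (h : (r : ℕ∞) ≤ analyticOrderAt (fun t => f t - H.eval t) c) (hD : (X - C c) ^ r ∣ D) :
    (r : ℕ∞) ≤ analyticOrderAt (fun t => f t - (H + D).eval t) c := by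
  have h2 := (natCast_le_analyticOrderAt_eval_iff D c r).2 hD
  have h3 : (fun t => f t - (H + D).eval t) =
      (fun t => f t - H.eval t) - fun t => D.eval t := by
    ext t; simp; ring
  rw [h3]
  exact (le_min h h2).trans le_analyticOrderAt_sub

theorem X_sub_C_pow_dvd_sub {f : ℝ → ℝ} {H K : ℝ[X]} {c : ℝ} {r : ℕ}
    (h : (r : ℕ∞) ≤ analyticOrderAt (fun t => f t - H.eval t) c)
    (k : (r : ℕ∞) ≤ analyticOrderAt (fun t => f t - K.eval t) c) : (X - C c) ^ r ∣ K - H := by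
  rw [← natCast_le_analyticOrderAt_eval_iff]
  have h3 : (fun t => (K - H).eval t) =
      (fun t => f t - H.eval t) - fun t => f t - K.eval t := by
    ext t; simp
  rw [h3]
  exact (le_min h k).trans le_analyticOrderAt_sub

/-- The nodal polynomial with node `a` of multiplicity `r` and node `b` of multiplicity `s`. -/
noncomputable def nodal (a b : ℝ) (r s : ℕ) : ℝ[X] := (X - C a) ^ r * (X - C b) ^ s

theorem nodal_monic (a b : ℝ) (r s : ℕ) : (nodal a b r s).Monic :=
  ((monic_X_sub_C a).pow r).mul ((monic_X_sub_C b).pow s)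

theorem nodal_natDegree (a b : ℝ) (r s : ℕ) : (nodal a b r s).natDegree = r + s := by
  rw [nodal, ((monic_X_sub_C a).pow r).natDegree_mul ((monic_X_sub_C b).pow s)]
  simp

theorem nodal_coeff (a b : ℝ) (r s : ℕ) : (nodal a b r s).coeff (r + s) = 1 := by
  have h := (nodal_monic a b r s).coeff_natDegree
  rwa [nodal_natDegree] at h

theorem nodal_eval (a b : ℝ) (r s : ℕ) (t : ℝ) :
    (nodal a b r s).eval t = (t - a) ^ r * (t - b) ^ s := by simp [nodal]

/-- Two polynomials of degree at most `r + s` with the same Hermite data differ by a multiple of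
the nodal polynomial. -/
theorem sub_eq_C_mul_nodal {f : ℝ → ℝ} {H K : ℝ[X]} {a b : ℝ} (hab : a < b) {r s : ℕ}
    (hH : H.natDegree ≤ r + s) (hK : K.natDegree ≤ r + s)
    (hHa : (r : ℕ∞) ≤ analyticOrderAt (fun t => f t - H.eval t) a)
    (hHb : (s : ℕ∞) ≤ analyticOrderAt (fun t => f t - H.eval t) b)
    (hKa : (r : ℕ∞) ≤ analyticOrderAt (fun t => f t - K.eval t) a)
    (hKb : (s : ℕ∞) ≤ analyticOrderAt (fun t => f t - K.eval t) b) :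
    K - H = C (K.coeff (r + s) - H.coeff (r + s)) * nodal a b r s := by
  have hdvd : nodal a b r s ∣ K - H :=
    ((isCoprime_X_sub_C_of_isUnit_sub (sub_ne_zero.2 hab.ne).isUnit).pow).mul_dvd
      (X_sub_C_pow_dvd_sub hHa hKa) (X_sub_C_pow_dvd_sub hHb hKb)
  rw [← sub_eq_zero]
  refine eq_zero_of_dvd_of_degree_lt (dvd_sub hdvd (dvd_mul_left _ _)) ?_
  rw [degree_eq_natDegree (nodal_monic a b r s).ne_zero, nodal_natDegree, degree_lt_iff_coeff_zero]
  intro m hm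
  rcases hm.eq_or_lt with rfl | hm
  · rw [coeff_sub, coeff_C_mul, nodal_coeff, coeff_sub, mul_one, sub_self]
  · have h1 := coeff_eq_zero_of_natDegree_lt (hH.trans_lt hm)
    have h2 := coeff_eq_zero_of_natDegree_lt (hK.trans_lt hm)
    have h3 := coeff_eq_zero_of_natDegree_lt ((nodal_natDegree a b r s).trans_lt hm)
    rw [coeff_sub, coeff_C_mul, h3, coeff_sub, h1, h2, mul_zero, sub_self, sub_self]

/-- The leading coefficient of a Hermite interpolant has the sign of the corresponding
derivative. -/
theorem coeff_pos_of_interpolates {f : ℝ → ℝ} {a b σ : ℝ} (hab : a < b)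
    (hf : ∀ t ∈ Icc a b, AnalyticAt ℝ f t) {N r s : ℕ}
    (hσ : ∀ t ∈ Ioo a b, 0 < σ * iteratedDeriv N f t) {K : ℝ[X]} (hK : K.natDegree ≤ N)
    (S : Finset ℝ) (hne : S.Nonempty) (hS : ∀ t ∈ S, t ∈ Ioo a b ∧ K.eval t = f t)
    (hN : N + 1 = S.card + r + s)
    (ha : (r : ℕ∞) ≤ analyticOrderAt (fun t => f t - K.eval t) a)
    (hb : (s : ℕ∞) ≤ analyticOrderAt (fun t => f t - K.eval t) b) :
    0 < σ * K.coeff N := by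
  have hh : ∀ t ∈ Icc a b, AnalyticAt ℝ (fun t => f t - K.eval t) t := fun t ht =>
    (hf t ht).fun_sub (analyticAt_eval K t)
  rw [natCast_le_analyticOrderAt_iff_iteratedDeriv_eq_zero (hh a (left_mem_Icc.2 hab.le))] at ha
  rw [natCast_le_analyticOrderAt_iff_iteratedDeriv_eq_zero (hh b (right_mem_Icc.2 hab.le))] at hb
  obtain ⟨T, hT, hc⟩ := exists_finset_zeros_iteratedDeriv hab hh S
    (fun t ht => ⟨(hS t ht).1, by rw [(hS t ht).2, sub_self]⟩)
    (fun j hj => ha j hj) (fun j hj => hb j hj) N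
  have hpos := hne.card_pos
  have hTpos : 0 < T.card := by omega
  obtain ⟨z, hz⟩ := Finset.card_pos.1 hTpos
  obtain ⟨hz, hz0⟩ := hT z hz
  have hz' := Ioo_subset_Icc_self hz
  rw [iteratedDeriv_fun_sub (hf z hz').contDiffAt (analyticAt_eval K z).contDiffAt,
    iteratedDeriv_eval, sub_eq_zero] at hz0
  have hdeg : (derivative^[N] K).natDegree = 0 := by
    have := natDegree_iterate_derivative K N
    omega
  have h1 := hσ z hz
  rw [hz0, eq_C_of_natDegree_eq_zero hdeg] at h1
  simp only [eval_C, coeff_iterate_derivative, zero_add, Nat.descFactorial_self, nsmul_eq_mul] at h1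
  have h2 : (0 : ℝ) < (N.factorial : ℝ) := by positivity
  exact pos_of_mul_pos_right (by linarith : 0 < (N.factorial : ℝ) * (σ * K.coeff N)) h2.le

section DividedDifference

variable {f : ℝ → ℝ} {a b σ x y D E : ℝ} {r s : ℕ}

theorem IsDD.pos (h : IsDD f x a b r s D) (hf : ∀ t ∈ Icc a b, AnalyticAt ℝ f t)
    (hσ : ∀ t ∈ Ioo a b, 0 < σ * iteratedDeriv (r + s) f t) (hx : x ∈ Ioo a b) :
    0 < σ * D := by
  obtain ⟨H, hdeg, rfl, hHx, ha, hb⟩ := h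
  have hab := hx.1.trans hx.2
  exact coeff_pos_of_interpolates hab hf hσ hdeg {x} (by simp) (by simp [hHx, hx.1, hx.2])
    (r := r) (s := s) (by simp; omega)
    (natCast_le_analyticOrderAt_sub_eval (hf a (left_mem_Icc.2 hab.le)) ha)
    (natCast_le_analyticOrderAt_sub_eval (hf b (right_mem_Icc.2 hab.le)) hb)

/-- Exchanging the node at a root `c` of the nodal polynomial for a second interior node. -/
theorem IsDD.exchange_pos {c : ℝ} {r' s' : ℕ} (hD : IsDD f x a b r s D)
    (hE : IsDD f y a b r s E) (hf : ∀ t ∈ Icc a b, AnalyticAt ℝ f t)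
    (hσ : ∀ t ∈ Ioo a b, 0 < σ * iteratedDeriv (r + s) f t)
    (hx : x ∈ Ioo a b) (hy : y ∈ Ioo a b) (hxy : x < y) (hr : r' ≤ r) (hs : s' ≤ s)
    (hrs : r + s = r' + s' + 1)
    (hc : nodal a b r s = nodal a b r' s' * (X - C c)) :
    σ * ((x - c) * D) < σ * ((y - c) * E) := by
  obtain ⟨H, hHdeg, rfl, hHx, hHa, hHb⟩ := hD
  obtain ⟨K, hKdeg, rfl, hKy, hKa, hKb⟩ := hE
  have hab := hx.1.trans hx.2
  have hfa := hf a (left_mem_Icc.2 hab.le)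
  have hfb := hf b (right_mem_Icc.2 hab.le)
  replace hHa := natCast_le_analyticOrderAt_sub_eval hfa hHa
  replace hHb := natCast_le_analyticOrderAt_sub_eval hfb hHb
  replace hKa := natCast_le_analyticOrderAt_sub_eval hfa hKa
  replace hKb := natCast_le_analyticOrderAt_sub_eval hfb hKb
  have hsub := sub_eq_C_mul_nodal hab hHdeg hKdeg hHa hHb hKa hKb
  set γ := (K.coeff (r + s) - H.coeff (r + s)) * (y - c) / (y - x) with hγ
  have hyx : 0 < y - x := sub_pos.2 hxy
  set L : ℝ[X] := C γ * (nodal a b r' s' * (X - C x)) with hL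
  have hmonic : (nodal a b r' s' * (X - C x)).Monic := (nodal_monic _ _ _ _).mul (monic_X_sub_C x)
  have hmdeg : (nodal a b r' s' * (X - C x)).natDegree = r + s := by
    rw [(nodal_monic _ _ _ _).natDegree_mul (monic_X_sub_C x), nodal_natDegree, natDegree_X_sub_C,
      hrs]
  have hLdeg : L.natDegree ≤ r + s := (natDegree_C_mul_le _ _).trans hmdeg.le
  have hLcoeff : L.coeff (r + s) = γ := by
    have h := hmonic.coeff_natDegree
    rw [hmdeg] at h
    rw [hL, coeff_C_mul, h, mul_one]
  have hLa : (X - C a) ^ r' ∣ L :=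
    ((dvd_mul_right _ _).mul_right (X - C x)).mul_left (C γ)
  have hLb : (X - C b) ^ s' ∣ L :=
    ((dvd_mul_left _ _).mul_right (X - C x)).mul_left (C γ)
  have hLy : (H + L).eval y = f y := by
    have h1 := congrArg (eval y) hsub
    rw [hc] at h1
    simp only [eval_sub, eval_mul, eval_C, eval_X, hKy] at h1
    simp only [hL, eval_add, eval_mul, eval_C, eval_sub, eval_X, hγ]
    field_simp
    linarith
  have hpos := coeff_pos_of_interpolates hab hf hσ (natDegree_add_le_of_degree_le hHdeg hLdeg)
    {x, y} (by simp)
    (by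
      intro t ht
      rcases Finset.mem_insert.1 ht with rfl | ht
      · exact ⟨hx, by simp [hL, hHx]⟩
      · rw [Finset.mem_singleton.1 ht]
        exact ⟨hy, hLy⟩)
    (r := r') (s := s') (by rw [Finset.card_pair hxy.ne]; omega)
    (le_analyticOrderAt_sub_eval_add ((Nat.cast_le.2 hr).trans hHa) hLa)
    (le_analyticOrderAt_sub_eval_add ((Nat.cast_le.2 hs).trans hHb) hLb)
  rw [coeff_add, hLcoeff] at hpos
  have h2 := mul_pos hyx hpos
  have h3 : (y - x) * (σ * (H.coeff (r + s) + γ)) =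
      σ * ((y - c) * K.coeff (r + s)) - σ * ((x - c) * H.coeff (r + s)) := by
    rw [hγ]; field_simp; ring
  linarith

theorem IsDD.left_strictMono (hD : IsDD f x a b (r + 1) s D) (hE : IsDD f y a b (r + 1) s E)
    (hf : ∀ t ∈ Icc a b, AnalyticAt ℝ f t)
    (hσ : ∀ t ∈ Ioo a b, 0 < σ * iteratedDeriv (r + 1 + s) f t)
    (hx : x ∈ Ioo a b) (hy : y ∈ Ioo a b) (hxy : x < y) :
    σ * ((x - a) * D) < σ * ((y - a) * E) :=
  hD.exchange_pos hE hf hσ hx hy hxy (r' := r) (s' := s) (by omega) le_rfl (by omega)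
    (by rw [nodal, nodal]; ring)

theorem IsDD.right_strictAnti (hD : IsDD f x a b r (s + 1) D) (hE : IsDD f y a b r (s + 1) E)
    (hf : ∀ t ∈ Icc a b, AnalyticAt ℝ f t)
    (hσ : ∀ t ∈ Ioo a b, 0 < σ * iteratedDeriv (r + (s + 1)) f t)
    (hx : x ∈ Ioo a b) (hy : y ∈ Ioo a b) (hxy : x < y) :
    σ * ((b - y) * E) < σ * ((b - x) * D) := by
  have h := hD.exchange_pos hE hf hσ hx hy hxy (r' := r) (s' := s) (c := b) le_rfl (by omega)
    (by omega) (by rw [nodal, nodal]; ring)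
  linarith

end DividedDifference

/-- The weighted difference of the two divided differences is strictly monotone in `x`. -/
theorem weighted_isDD_lt {f : ℝ → ℝ} {a b σ x y Fx Fy Gx Gy : ℝ} {m₁ m₂ d : ℕ} (hd : d ≠ 0)
    (hf : ∀ t ∈ Icc a b, AnalyticAt ℝ f t)
    (hσ : ∀ t ∈ Ioo a b, 0 < σ * iteratedDeriv (m₁ + 1 + (m₂ + 1)) f t)
    (hFx : IsDD f x a b (m₁ + 1) (m₂ + 1) Fx) (hFy : IsDD f y a b (m₁ + 1) (m₂ + 1) Fy)
    (hGx : IsDD f x a b (m₂ + 1) (m₁ + 1) Gx) (hGy : IsDD f y a b (m₂ + 1) (m₁ + 1) Gy)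
    (hx : x ∈ Ioo a b) (hy : y ∈ Ioo a b) (hxy : x < y) :
    σ * ((x - a) ^ d * Fx - (b - x) ^ d * Gx) < σ * ((y - a) ^ d * Fy - (b - y) ^ d * Gy) := by
  obtain ⟨e, rfl⟩ := Nat.exists_eq_succ_of_ne_zero hd
  have hσ' : ∀ t ∈ Ioo a b, 0 < σ * iteratedDeriv (m₂ + 1 + (m₁ + 1)) f t := by
    rwa [add_comm (m₂ + 1)]
  have h1 := hFx.left_strictMono hFy hf hσ hx hy hxy
  have h2 := hGx.right_strictAnti hGy hf hσ' hx hy hxy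
  have h3 := hFx.pos hf hσ hx
  have h4 := hGy.pos hf hσ' hy
  have hxa : 0 < x - a := sub_pos.2 hx.1
  have hby : 0 < b - y := sub_pos.2 hy.2
  have h5 : (x - a) ^ e ≤ (y - a) ^ e := pow_le_pow_left₀ hxa.le (by linarith) e
  have h6 : (b - y) ^ e ≤ (b - x) ^ e := pow_le_pow_left₀ hby.le (by linarith) e
  have h7 : (x - a) ^ e * (σ * ((x - a) * Fx)) < (y - a) ^ e * (σ * ((y - a) * Fy)) :=
    mul_lt_mul' h5 h1 (by nlinarith [mul_pos hxa h3]) (by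
      have : 0 < y - a := by linarith
      positivity)
  have h8 : (b - y) ^ e * (σ * ((b - y) * Gy)) < (b - x) ^ e * (σ * ((b - x) * Gx)) :=
    mul_lt_mul' h6 h2 (by nlinarith [mul_pos hby h4]) (by
      have : 0 < b - x := by linarith
      positivity)
  simp only [Nat.succ_eq_add_one, pow_succ]
  linarith

theorem exists_eval_eq_pow_mul_eval_div (P : ℝ[X]) {n : ℕ} (hP : P.natDegree ≤ n) (c : ℝ) :
    ∃ Q : ℝ[X], Q.natDegree ≤ n ∧ ∀ t ≠ 0, Q.eval t = t ^ n * P.eval (c / t) := by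
  refine ⟨∑ i ∈ Finset.range (n + 1), C (P.coeff i * c ^ i) * X ^ (n - i), ?_, ?_⟩
  · refine natDegree_sum_le_of_forall_le _ _ fun i _ => ?_
    exact (natDegree_C_mul_X_pow_le _ _).trans (Nat.sub_le _ _)
  · intro t ht
    rw [eval_eq_sum_range' (Nat.lt_succ_of_le hP), eval_finsetSum, Finset.mul_sum]
    refine Finset.sum_congr rfl fun i hi => ?_
    have hi' : i ≤ n := Nat.lt_succ_iff.1 (Finset.mem_range.1 hi)
    obtain ⟨k, rfl⟩ := Nat.exists_eq_add_of_le hi'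
    simp only [eval_mul, eval_C, eval_pow, eval_X, Nat.add_sub_cancel_left]
    rw [div_pow, pow_add]
    field_simp

theorem analyticAt_rpow_const {t : ℝ} (ht : 0 < t) (p : ℝ) :
    AnalyticAt ℝ (fun t : ℝ => t ^ p) t :=
  (Real.contDiffAt_rpow_const_of_ne ht.ne').analyticAt

/-- The involution `P ↦ tⁿ P(ab/t) / (ab)^(n/2)` fixes `t^(n/2)` and exchanges the orders of
contact at `a` and at `b`. -/
theorem le_analyticOrderAt_reflect {p : ℝ} {n : ℕ} (hp : 2 * p = n) {P Q : ℝ[X]} {c d : ℝ}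
    (hc : 0 < c) (hd : 0 < d) {k : ℕ∞}
    (hQ : ∀ t ≠ 0, Q.eval t = t ^ n * P.eval (c * d / t))
    (h : k ≤ analyticOrderAt (fun t : ℝ => t ^ p - P.eval t) d) :
    k ≤ analyticOrderAt (fun t : ℝ => t ^ p - (C ((c * d) ^ p)⁻¹ * Q).eval t) c := by
  have hcd : 0 < c * d := mul_pos hc hd
  have hcp : (c * d) ^ p ≠ 0 := (Real.rpow_pos_of_pos hcd p).ne'
  set g : ℝ → ℝ := fun t => c * d / t with hg
  have hgc : g c = d := by simp only [hg]; field_simp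
  have hga : AnalyticAt ℝ g c := analyticAt_const.div analyticAt_id hc.ne'
  have hgd : deriv g c ≠ 0 := by
    have : HasDerivAt g _ c := (hasDerivAt_const c (c * d)).div (hasDerivAt_id c) hc.ne'
    rw [this.deriv]
    simp only [zero_mul, mul_one, zero_sub]
    exact div_ne_zero (neg_ne_zero.2 hcd.ne') (pow_ne_zero 2 hc.ne')
  set u : ℝ → ℝ := fun t => t ^ p - P.eval t with hu
  have hua : AnalyticAt ℝ u (g c) := by
    rw [hgc]; exact (analyticAt_rpow_const hd p).fun_sub (analyticAt_eval P d)
  have heq : (fun t : ℝ => t ^ p - (C ((c * d) ^ p)⁻¹ * Q).eval t) =ᶠ[𝓝 c]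
      (fun t => ((c * d) ^ p)⁻¹ * t ^ n) * (u ∘ g) := by
    filter_upwards [lt_mem_nhds hc] with t ht
    have h1 : t ^ n = t ^ p * t ^ p := by
      rw [← Real.rpow_natCast, ← hp, two_mul, Real.rpow_add ht]
    have h2 : (c * d / t) ^ p = (c * d) ^ p / t ^ p := Real.div_rpow hcd.le ht.le p
    have h3 : t ^ p ≠ 0 := (Real.rpow_pos_of_pos ht p).ne'
    simp only [Pi.mul_apply, Function.comp, hu, hg, eval_mul, eval_C, hQ t ht.ne', h1, h2]
    field_simp
  rw [analyticOrderAt_congr heq, analyticOrderAt_mul (by fun_prop) (hua.comp hga),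
    analyticOrderAt_comp_of_deriv_ne_zero hga hgd, hgc]
  exact h.trans le_add_self

theorem natDegree_sub_C_mul_nodal_le {H : ℝ[X]} {a b : ℝ} {r s n : ℕ} (hn : r + s = n + 1)
    (hH : H.natDegree ≤ r + s) :
    (H - C (H.coeff (r + s)) * nodal a b r s).natDegree ≤ n := by
  rw [natDegree_le_iff_coeff_eq_zero]
  intro m hm
  rcases (show r + s ≤ m by omega).eq_or_lt with rfl | hm
  · simp [nodal_coeff]
  · have h1 := coeff_eq_zero_of_natDegree_lt (hH.trans_lt hm)
    have h3 := coeff_eq_zero_of_natDegree_lt ((nodal_natDegree a b r s).trans_lt hm)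
    simp [h1, h3]

theorem le_analyticOrderAt_sub_C_mul_nodal {f : ℝ → ℝ} {H : ℝ[X]} {a b : ℝ} {r s : ℕ} (k : ℝ)
    (ha : (r : ℕ∞) ≤ analyticOrderAt (fun t => f t - H.eval t) a)
    (hb : (s : ℕ∞) ≤ analyticOrderAt (fun t => f t - H.eval t) b) :
    (r : ℕ∞) ≤ analyticOrderAt (fun t => f t - (H - C k * nodal a b r s).eval t) a ∧
      (s : ℕ∞) ≤ analyticOrderAt (fun t => f t - (H - C k * nodal a b r s).eval t) b := by
  simp only [sub_eq_add_neg H]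
  exact ⟨le_analyticOrderAt_sub_eval_add ha (((dvd_mul_right _ _).mul_left _).neg_right),
    le_analyticOrderAt_sub_eval_add hb (((dvd_mul_left _ _).mul_left _).neg_right)⟩

/-- At the geometric mean the remainders of the two Hermite interpolants of `t^(n/2)` with
exchanged multiplicities agree. -/
theorem isDD_rpow_sqrt {p a b D E : ℝ} {n r s : ℕ} (hp : 2 * p = n) (hn : r + s = n + 1)
    (ha : 0 < a) (hab : a < b)
    (hD : IsDD (fun t => t ^ p) (√(a * b)) a b r s D)
    (hE : IsDD (fun t => t ^ p) (√(a * b)) a b s r E) :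
    (√(a * b) - a) ^ r * (√(a * b) - b) ^ s * D =
      (√(a * b) - a) ^ s * (√(a * b) - b) ^ r * E := by
  have hb : 0 < b := ha.trans hab
  have habp : 0 < a * b := mul_pos ha hb
  obtain ⟨H, hHdeg, rfl, hHx, hHa, hHb⟩ := hD
  obtain ⟨K, hKdeg, rfl, hKx, hKa, hKb⟩ := hE
  have hfa := analyticAt_rpow_const ha p
  have hfb := analyticAt_rpow_const hb p
  have hn' : s + r = n + 1 := by omega
  have hPdeg := natDegree_sub_C_mul_nodal_le (a := a) (b := b) hn hHdeg
  have hRdeg := natDegree_sub_C_mul_nodal_le (a := a) (b := b) hn' hKdeg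
  obtain ⟨hPa, hPb⟩ := le_analyticOrderAt_sub_C_mul_nodal (H.coeff (r + s))
    (natCast_le_analyticOrderAt_sub_eval hfa hHa) (natCast_le_analyticOrderAt_sub_eval hfb hHb)
  obtain ⟨hRa, hRb⟩ := le_analyticOrderAt_sub_C_mul_nodal (K.coeff (s + r))
    (natCast_le_analyticOrderAt_sub_eval hfa hKa) (natCast_le_analyticOrderAt_sub_eval hfb hKb)
  set P := H - C (H.coeff (r + s)) * nodal a b r s with hP
  set R := K - C (K.coeff (s + r)) * nodal a b s r with hR
  obtain ⟨Q, hQdeg, hQ⟩ := exists_eval_eq_pow_mul_eval_div P hPdeg (a * b)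
  have hTdeg : (C ((a * b) ^ p)⁻¹ * Q).natDegree ≤ n := (natDegree_C_mul_le _ _).trans hQdeg
  have hTa := le_analyticOrderAt_reflect hp ha hb hQ hPb
  have hTb := le_analyticOrderAt_reflect hp hb ha (by simpa only [mul_comm b a] using hQ) hPa
  rw [mul_comm b a] at hTb
  have hsub := sub_eq_C_mul_nodal hab (by omega) (by omega) hRa hRb hTa hTb
  rw [coeff_eq_zero_of_natDegree_lt (by omega : (C ((a * b) ^ p)⁻¹ * Q).natDegree < s + r),
    coeff_eq_zero_of_natDegree_lt (by omega : R.natDegree < s + r), sub_zero, C_0, zero_mul,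
    sub_eq_zero] at hsub
  have hs0 : 0 < √(a * b) := Real.sqrt_pos.2 habp
  have hsn : √(a * b) ^ n = (a * b) ^ p := by
    rw [Real.sqrt_eq_rpow, ← Real.rpow_natCast, ← Real.rpow_mul habp.le, ← hp]
    congr 1; ring
  have hPR : R.eval √(a * b) = P.eval √(a * b) := by
    rw [← hsub, eval_mul, eval_C, hQ _ hs0.ne', hsn, Real.div_sqrt, ← mul_assoc,
      inv_mul_cancel₀ (Real.rpow_pos_of_pos habp p).ne', one_mul]
  simp only [hP, hR, eval_sub, eval_mul, eval_C, nodal_eval, hHx, hKx] at hPR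
  linarith

theorem exists_mul_iteratedDeriv_rpow_pos {p : ℝ} (hp : ∀ k : ℕ, p ≠ k) (N : ℕ) :
    ∃ σ : ℝ, ∀ t > 0, 0 < σ * iteratedDeriv N (fun t : ℝ => t ^ p) t := by
  refine ⟨(descPochhammer ℝ N).eval p, fun t ht => ?_⟩
  rw [iteratedDeriv_eq_iterate, Real.iter_deriv_rpow_const, ← mul_assoc]
  refine mul_pos (mul_self_pos.2 ?_) (Real.rpow_pos_of_pos ht _)
  rw [descPochhammer_eval_eq_prod_range, Finset.prod_ne_zero_iff]
  exact fun k _ => sub_ne_zero.2 (hp k)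

theorem stmt10 (m₁ m₂ : ℕ) (hm : m₂ < m₁) (heven : Even (m₁ + m₂))
    (a b : ℝ) (ha : 0 < a) (hab : a < b) (F G : ℝ → ℝ)
    (hF : ∀ x ∈ Set.Ioo a b,
      IsDD (fun t => t ^ ((m₁ + m₂ + 1 : ℝ) / 2)) x a b (m₁ + 1) (m₂ + 1) (F x))
    (hG : ∀ x ∈ Set.Ioo a b,
      IsDD (fun t => t ^ ((m₁ + m₂ + 1 : ℝ) / 2)) x a b (m₂ + 1) (m₁ + 1) (G x)) :
    Real.sqrt (a * b) ∈ Set.Ioo a b ∧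
      ∀ x ∈ Set.Ioo a b,
        ((x - a) ^ (m₁ - m₂) * F x = (b - x) ^ (m₁ - m₂) * G x ↔ x = Real.sqrt (a * b)) := by
  have hb : 0 < b := ha.trans hab
  have hmem : Real.sqrt (a * b) ∈ Set.Ioo a b := by
    constructor
    · rw [Real.lt_sqrt ha.le]; nlinarith
    · rw [Real.sqrt_lt' hb]; nlinarith
  refine ⟨hmem, ?_⟩
  set p : ℝ := (m₁ + m₂ + 1 : ℝ) / 2 with hp
  have hp2 : 2 * p = ((m₁ + m₂ + 1 : ℕ) : ℝ) := by rw [hp]; push_cast; ring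
  have hpk : ∀ k : ℕ, p ≠ k := by
    intro k hk
    rw [hk] at hp2
    have h : 2 * k = m₁ + m₂ + 1 := by exact_mod_cast hp2
    obtain ⟨l, hl⟩ := heven
    omega
  obtain ⟨σ, hσ⟩ := exists_mul_iteratedDeriv_rpow_pos hpk (m₁ + 1 + (m₂ + 1))
  have hf : ∀ t ∈ Icc a b, AnalyticAt ℝ (fun t : ℝ => t ^ p) t := fun t ht =>
    analyticAt_rpow_const (ha.trans_le ht.1) p
  have hlt : ∀ x ∈ Ioo a b, ∀ y ∈ Ioo a b, x < y →
      σ * ((x - a) ^ (m₁ - m₂) * F x - (b - x) ^ (m₁ - m₂) * G x) <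
        σ * ((y - a) ^ (m₁ - m₂) * F y - (b - y) ^ (m₁ - m₂) * G y) := fun x hx y hy hxy =>
    weighted_isDD_lt (by omega) hf (fun t ht => hσ t (ha.trans ht.1)) (hF x hx) (hF y hy)
      (hG x hx) (hG y hy) hx hy hxy
  have hroot : (√(a * b) - a) ^ (m₁ - m₂) * F √(a * b) =
      (b - √(a * b)) ^ (m₁ - m₂) * G √(a * b) := by
    have h := isDD_rpow_sqrt hp2 (by omega) ha hab (hF _ hmem) (hG _ hmem)
    have hd : Even (m₁ - m₂) := by
      obtain ⟨l, hl⟩ := heven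
      exact ⟨l - m₂, by omega⟩
    have hm1 : m₁ + 1 = m₂ + 1 + (m₁ - m₂) := by omega
    have h1 : √(a * b) - a ≠ 0 := (sub_pos.2 hmem.1).ne'
    have h2 : √(a * b) - b ≠ 0 := (sub_neg.2 hmem.2).ne
    rw [← hd.neg_pow (b - √(a * b)), neg_sub]
    rw [hm1, pow_add _ (m₂ + 1), pow_add _ (m₂ + 1)] at h
    refine mul_left_cancel₀ (mul_ne_zero (pow_ne_zero (m₂ + 1) h1) (pow_ne_zero (m₂ + 1) h2)) ?_
    linarith
  intro x hx
  constructor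
  · intro hxe
    rcases lt_trichotomy x (√(a * b)) with h | h | h
    · have := hlt x hx _ hmem h
      rw [hxe, hroot] at this
      simp at this
    · exact h
    · have := hlt _ hmem x hx h
      rw [hxe, hroot] at this
      simp at this
  · rintro rfl
    exact hroot
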